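/- Let F be the Minkowski gauge of a compact convex body K ⊂ ℝⁿ with 0 in its interior, with F of class C¹ on ℝⁿ∖{0}, C ≥ 1 a constant with F(−v) ≤ C·F(v) for all v, and assume the Legendre map ℓ is a homeomorphism of ℝⁿ onto (ℝⁿ)*. Let p > 1, let μ be a Borel probability measure with supp(μ) ⊆ B(x₀,R), write E = E_{μ,p}, and assume: E is strictly convex on B̄(x₀, C(1+C)R), and there is C_H > 0 such that E(x+tv) ≤ E(x) + ⟨D E(x), v⟩·t + (C_H/2)·t² for all x ∈ B̄(x₀, C(1+C)R), all v with F(v) = 1, and all t ∈ [0, F*(−D E(x))/C_H]. Define the gradient algorithm: x₁ = x₀, and for k ≥ 1, if D E(x_k) ≠ 0 set w_k = ℓ⁻¹(−D E(x_k)), v_k = w_k / F(w_k), t_k = F(w_k)/C_H, x_{k+1} = x_k + t_k·v_k, and set x_{k+1} = x_k if D E(x_k) = 0. Then x_k ∈ B̄(x₀, C(1+C)R) for all k, and the sequence (x_k) converges to the unique minimizer e_p of E on B̄(x₀, C(1+C)R). -/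

import Mathlib

open MeasureTheory

open Set Filter Topology

section Auxiliary

variable {V : Type*} [NormedAddCommGroup V] [NormedSpace ℝ V]

/-- The first-order characterisation of convexity for functions on a normed space. -/
lemma ConvexOn.add_fderiv_le {s : Set V} {f : V → ℝ} (hf : ConvexOn ℝ s f) {x y : V}
    (hx : x ∈ s) (hy : y ∈ s) (hd : DifferentiableAt ℝ f x) :
    f x + fderiv ℝ f x (y - x) ≤ f y := by
  have hline : HasDerivAt (AffineMap.lineMap x y : ℝ → V) (y - x) 0 :=
    AffineMap.hasDerivAt_lineMap
  have hx' : HasFDerivAt f (fderiv ℝ f x) ((AffineMap.lineMap x y : ℝ →ᵃ[ℝ] V) (0 : ℝ)) := by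
    simpa using hd.hasFDerivAt
  have := (hf.comp_affineMap (AffineMap.lineMap x y : ℝ →ᵃ[ℝ] V)).le_slope_of_hasDerivAt
    (x := 0) (y := 1) (by simpa using hx) (by simpa using hy) one_pos
    (hx'.comp_hasDerivAt (0 : ℝ) hline)
  simp only [slope_def_field, Function.comp_apply, AffineMap.lineMap_apply_one,
    AffineMap.lineMap_apply_zero, sub_zero, div_one] at this
  linarith

lemma Real.lipschitzOnWith_rpow_const {p : ℝ} (hp : 1 ≤ p) (M : ℝ) :
    ∃ L, LipschitzOnWith L (fun t : ℝ => t ^ p) (Icc 0 M) := by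
  refine ⟨(p * |M| ^ (p - 1)).toNNReal, Convex.lipschitzOnWith_of_nnnorm_deriv_le
    (fun t _ => (Real.hasDerivAt_rpow_const (Or.inr hp)).differentiableAt) (fun t ht => ?_)
    (convex_Icc 0 M)⟩
  rw [← NNReal.coe_le_coe, coe_nnnorm, (Real.hasDerivAt_rpow_const (Or.inr hp)).deriv,
    Real.coe_toNNReal _ (by positivity), Real.norm_eq_abs,
    abs_of_nonneg (mul_nonneg (by linarith) (Real.rpow_nonneg ht.1 _))]
  refine mul_le_mul_of_nonneg_left (Real.rpow_le_rpow ht.1 ?_ (by linarith)) (by linarith)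
  exact ht.2.trans (le_abs_self M)

/-- A power `p ≥ 1` of a nonnegative Lipschitz function is Lipschitz on bounded sets. -/
lemma LipschitzWith.rpow_const_lipschitzOnWith {V : Type*} [SeminormedAddCommGroup V]
    {F : V → ℝ} {L : NNReal}
    (hL : LipschitzWith L F) (h0 : F 0 = 0) (hnn : ∀ v, 0 ≤ F v) {p : ℝ} (hp : 1 ≤ p)
    (r : ℝ) : ∃ L', LipschitzOnWith L' (fun v => F v ^ p) (Metric.closedBall 0 r) := by
  obtain ⟨L₁, hL₁⟩ := Real.lipschitzOnWith_rpow_const hp (L * r)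
  refine ⟨L₁ * L, hL₁.comp hL.lipschitzOnWith fun v hv => ⟨hnn v, ?_⟩⟩
  have h := hL.dist_le_mul v 0
  rw [h0, Real.dist_0_eq_abs, abs_of_nonneg (hnn v)] at h
  exact h.trans (by gcongr; exact hv)

/-- A power `p > 1` of a nonnegative Lipschitz function vanishing at `0` and differentiable
elsewhere is differentiable everywhere. -/
lemma LipschitzWith.differentiable_rpow_const {V : Type*} [NormedAddCommGroup V]
    [InnerProductSpace ℝ V] {F : V → ℝ} {L : NNReal}
    (hL : LipschitzWith L F) (h0 : F 0 = 0) (hpos : ∀ v ≠ 0, 0 < F v)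
    (hd : ∀ v ≠ 0, DifferentiableAt ℝ F v) {p : ℝ} (hp : 1 < p) :
    Differentiable ℝ fun v => F v ^ p := by
  intro v
  rcases eq_or_ne v 0 with rfl | hv
  swap
  · exact (hd v hv).rpow_const (Or.inl (hpos v hv).ne')
  have hp0 : p ≠ 0 := by linarith
  have hO : (fun v => F v ^ p) =O[𝓝 0] fun v : V => ‖v‖ ^ p := by
    refine Asymptotics.IsBigO.of_bound ((L : ℝ) ^ p) (Eventually.of_forall fun v => ?_)
    have hnn : 0 ≤ F v := by
      rcases eq_or_ne v 0 with rfl | hv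
      · exact h0.ge
      · exact (hpos v hv).le
    have h := hL.dist_le_mul v 0
    rw [h0, Real.dist_0_eq_abs, abs_of_nonneg hnn, dist_zero_right] at h
    rw [Real.norm_of_nonneg (by positivity), Real.norm_of_nonneg (by positivity),
      ← Real.mul_rpow L.coe_nonneg (norm_nonneg v)]
    exact Real.rpow_le_rpow hnn h (by linarith)
  have ho : (fun v : V => ‖v‖ ^ p) =o[𝓝 0] fun v : V => v := by
    have h := (hasFDerivAt_norm_rpow (0 : V) hp).isLittleO
    simpa [Real.zero_rpow hp0] using h
  refine HasFDerivAt.differentiableAt (f' := 0) (.of_isLittleO ?_)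
  simpa [h0, Real.zero_rpow hp0] using hO.trans_isLittleO ho

/-- Differentiation under the integral sign for a convolution-type integral against a boundedly
supported measure. -/
lemma differentiable_integral_comp_sub [FiniteDimensional ℝ V] [MeasurableSpace V] [BorelSpace V]
    {G : V → ℝ} (hG : Differentiable ℝ G)
    (hlip : ∀ r, ∃ L, LipschitzOnWith L G (Metric.closedBall 0 r))
    {μ : Measure V} [IsFiniteMeasure μ] {r : ℝ} (hμ : ∀ᵐ z ∂μ, ‖z‖ ≤ r) :
    Differentiable ℝ fun x => ∫ z, G (z - x) ∂μ := by
  intro x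
  obtain ⟨L, hL⟩ := hlip (r + (‖x‖ + 1))
  have hball : ∀ z : V, ‖z‖ ≤ r → ∀ y ∈ Metric.closedBall x 1,
      z - y ∈ Metric.closedBall (0 : V) (r + (‖x‖ + 1)) := by
    intro z hz y hy
    rw [mem_closedBall_zero_iff]
    have h1 := norm_sub_le z y
    have h2 : ‖y - x‖ ≤ 1 := by simpa [dist_eq_norm] using hy
    have h3 := norm_le_norm_add_norm_sub' y x
    linarith
  have hmeas : ∀ y, AEStronglyMeasurable (fun z => G (z - y)) μ := fun y =>
    (hG.continuous.comp (continuous_id.sub continuous_const)).aestronglyMeasurable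
  have hint : Integrable (fun z => G (z - x)) μ := by
    obtain ⟨B, hB⟩ := (isCompact_closedBall (0 : V) (r + (‖x‖ + 1))).exists_bound_of_continuousOn
      hG.continuous.continuousOn
    refine .of_bound (hmeas x) B ?_
    filter_upwards [hμ] with z hz
    exact hB _ (hball z hz x (Metric.mem_closedBall_self zero_le_one))
  refine (hasFDerivAt_integral_of_dominated_loc_of_lip (F := fun x z => G (z - x))
    (F' := fun z => -fderiv ℝ G (z - x)) (bound := fun _ => (L : ℝ))
    (Metric.closedBall_mem_nhds x one_pos) (Eventually.of_forall hmeas) hint ?_ ?_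
    (integrable_const _) ?_).2.differentiableAt
  · exact (((measurable_fderiv ℝ G).comp
      (measurable_id.sub_const x)).neg).aestronglyMeasurable
  · filter_upwards [hμ] with z hz
    have h : LipschitzWith 1 fun y : V => z - y :=
      .of_dist_le_mul fun a b => by
      rw [dist_sub_left, NNReal.coe_one, one_mul]
    simpa [Function.comp_def] using hL.comp h.lipschitzOnWith (hball z hz)
  · refine Eventually.of_forall fun z => ?_
    have h1 : HasFDerivAt (fun y : V => z - y) (-ContinuousLinearMap.id ℝ V) x :=
      (hasFDerivAt_id x).const_sub z
    have h2 := ((hG (z - x)).hasFDerivAt).comp x h1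
    rw [ContinuousLinearMap.comp_neg, ContinuousLinearMap.comp_id] at h2
    exact h2

/-- Euler's identity for the square of a positively `1`-homogeneous function. -/
lemma fderiv_sq_apply_self_of_homogeneous {F : V → ℝ}
    (hhom : ∀ (t : ℝ) (v : V), 0 ≤ t → F (t • v) = t * F v) {v : V}
    (hd : DifferentiableAt ℝ F v) :
    fderiv ℝ (fun w => F w ^ 2) v v = 2 * F v ^ 2 := by
  have hline : HasDerivAt (fun t : ℝ => t • v) v 1 := by
    simpa using (hasDerivAt_id (1 : ℝ)).smul_const v
  have hd' : HasFDerivAt (fun w => F w ^ 2) (fderiv ℝ (fun w => F w ^ 2) v)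
      ((fun t : ℝ => t • v) 1) := by
    beta_reduce
    rw [one_smul]
    exact (hd.pow 2).hasFDerivAt
  have h1 := hd'.comp_hasDerivAt (1 : ℝ) hline
  have h2 : HasDerivAt (fun t : ℝ => t ^ 2 * F v ^ 2) (2 * F v ^ 2) 1 := by
    simpa using (hasDerivAt_pow 2 (1 : ℝ)).mul_const (F v ^ 2)
  refine h1.unique (h2.congr_of_eventuallyEq ?_)
  filter_upwards [lt_mem_nhds one_pos] with t ht
  simp [hhom t v ht.le, mul_pow]

/-- A sequence in a compact set along which the derivative of a strictly
convex function tends to `0` converges to the minimizer. -/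
lemma StrictConvexOn.tendsto_of_tendsto_fderiv_zero {s : Set V} {f : V → ℝ}
    (hf : StrictConvexOn ℝ s f) (hs : IsCompact s) (hd : Differentiable ℝ f) {x : ℕ → V}
    (hx : ∀ k, x k ∈ s) (hgrad : Tendsto (fun k => fderiv ℝ f (x k)) atTop (𝓝 0))
    {e : V} (he : e ∈ s) (hmin : IsMinOn f s e) : Tendsto x atTop (𝓝 e) := by
  obtain ⟨B, hB⟩ := hs.isBounded.exists_norm_le
  have hlim : Tendsto (fun k => f (x k)) atTop (𝓝 (f e)) := by
    have hup : Tendsto (fun k => f e + ‖fderiv ℝ f (x k)‖ * (B + B)) atTop (𝓝 (f e)) := by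
      simpa using (hgrad.norm.mul_const (B + B)).const_add (f e)
    refine tendsto_of_tendsto_of_tendsto_of_le_of_le tendsto_const_nhds hup
      (fun k => hmin (hx k)) fun k => ?_
    have h1 := hf.convexOn.add_fderiv_le (hx k) he (hd (x k))
    have h2 := (fderiv ℝ f (x k)).le_opNorm (e - x k)
    have h3 : ‖e - x k‖ ≤ B + B :=
      (norm_sub_le _ _).trans (add_le_add (hB e he) (hB _ (hx k)))
    have h4 := mul_le_mul_of_nonneg_left h3 (norm_nonneg (fderiv ℝ f (x k)))
    have h5 := neg_abs_le (fderiv ℝ f (x k) (e - x k))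
    rw [Real.norm_eq_abs] at h2
    dsimp only
    linarith
  refine hs.tendsto_nhds_of_unique_mapClusterPt (Eventually.of_forall hx) fun m hm hclus => ?_
  obtain ⟨U, hU, hUm⟩ := mapClusterPt_iff_ultrafilter.1 hclus
  have hfm : f m = f e :=
    tendsto_nhds_unique ((hd.continuous.tendsto m).comp hUm) (hlim.mono_left hU)
  exact hf.eq_of_isMinOn (fun y hy => hfm.trans_le (hmin hy)) hmin hm he

end Auxiliary

/-- Convergence of the gradient algorithm for `p`-means in the flat
Minkowski model: under strict convexity of `E = E_{μ,p}` on `B̄(x₀, C(1+C)R)` and a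
uniform second-order bound with constant `C_H`, the sequence defined by `x₁ = x₀` and
`x_{k+1} = x_k + t_k · v_k` with `w_k = ℓ⁻¹(-D E(x_k))`, `v_k = w_k / F(w_k)`,
`t_k = F(w_k)/C_H` (and `x_{k+1} = x_k` if `D E(x_k) = 0`) stays in `B̄(x₀, C(1+C)R)`
and converges to the unique minimizer `e_p` of `E` on that ball. -/
theorem p_mean_gradient_algorithm_converges
    {n : ℕ} (K : Set (EuclideanSpace ℝ (Fin n)))
    (hK_cpt : IsCompact K) (hK_conv : Convex ℝ K)
    (hK_int : (0 : EuclideanSpace ℝ (Fin n)) ∈ interior K)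
    (F : EuclideanSpace ℝ (Fin n) → ℝ) (hF : F = gauge K)
    (hFsmooth : ContDiffOn ℝ 1 F {(0 : EuclideanSpace ℝ (Fin n))}ᶜ)
    (C : ℝ) (hC : 1 ≤ C) (hrev : ∀ v, F (-v) ≤ C * F v)
    (ℓ : EuclideanSpace ℝ (Fin n) → (EuclideanSpace ℝ (Fin n) →L[ℝ] ℝ))
    (hℓ : ∀ v, v ≠ 0 → ℓ v = (1 / 2 : ℝ) • fderiv ℝ (fun w => F w ^ 2) v)
    (hℓ0 : ℓ 0 = 0)
    (ℓinv : (EuclideanSpace ℝ (Fin n) →L[ℝ] ℝ) → EuclideanSpace ℝ (Fin n))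
    (hleft : Function.LeftInverse ℓinv ℓ) (hright : Function.RightInverse ℓinv ℓ)
    (hℓcont : Continuous ℓ) (hℓinvcont : Continuous ℓinv)
    -- `Fs` is the dual gauge `F*`
    (Fs : (EuclideanSpace ℝ (Fin n) →L[ℝ] ℝ) → ℝ)
    (hFs : Fs = fun ξ : EuclideanSpace ℝ (Fin n) →L[ℝ] ℝ =>
      sSup (⇑ξ '' {y | F y ≤ 1}))
    (p : ℝ) (hp : 1 < p)
    (x₀ : EuclideanSpace ℝ (Fin n)) (R : ℝ) (hR : 0 < R)
    (μ : Measure (EuclideanSpace ℝ (Fin n))) [IsProbabilityMeasure μ]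
    (hsupp : μ {z | F (z - x₀) < R}ᶜ = 0)
    (E : EuclideanSpace ℝ (Fin n) → ℝ)
    (hE : E = fun x => ∫ z, F (z - x) ^ p ∂μ)
    (hEconv : StrictConvexOn ℝ {x | F (x - x₀) ≤ C * (1 + C) * R} E)
    (C_H : ℝ) (hCH : 0 < C_H)
    -- second-order (Hessian) bound on the ball
    (hhess : ∀ x, F (x - x₀) ≤ C * (1 + C) * R → ∀ v, F v = 1 →
      ∀ t ∈ Set.Icc (0 : ℝ) (Fs (-(fderiv ℝ E x)) / C_H),
        E (x + t • v) ≤ E x + fderiv ℝ E x v * t + C_H / 2 * t ^ 2)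
    -- the gradient algorithm
    (x : ℕ → EuclideanSpace ℝ (Fin n)) (hx0 : x 0 = x₀)
    (hstep : ∀ k : ℕ, fderiv ℝ E (x k) ≠ 0 →
      x (k + 1) = x k + (F (ℓinv (-(fderiv ℝ E (x k)))) / C_H) •
        ((F (ℓinv (-(fderiv ℝ E (x k)))))⁻¹ • ℓinv (-(fderiv ℝ E (x k)))))
    (hstep0 : ∀ k : ℕ, fderiv ℝ E (x k) = 0 → x (k + 1) = x k) :
    (∀ k : ℕ, F (x k - x₀) ≤ C * (1 + C) * R) ∧
    (∃ ep : EuclideanSpace ℝ (Fin n),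
      (F (ep - x₀) ≤ C * (1 + C) * R ∧
        ∀ y, F (y - x₀) ≤ C * (1 + C) * R → E ep ≤ E y) ∧
      (∀ m, (F (m - x₀) ≤ C * (1 + C) * R ∧
        ∀ y, F (y - x₀) ≤ C * (1 + C) * R → E m ≤ E y) → m = ep) ∧
      Filter.Tendsto x Filter.atTop (nhds ep)) := by
  have hnhds : K ∈ 𝓝 (0 : EuclideanSpace ℝ (Fin n)) := mem_interior_iff_mem_nhds.1 hK_int
  have habs : Absorbent ℝ K := absorbent_nhds_zero hnhds
  have hnn : ∀ v, 0 ≤ F v := fun v => hF ▸ gauge_nonneg v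
  have h0 : F 0 = 0 := hF ▸ gauge_zero
  have hadd : ∀ v w, F (v + w) ≤ F v + F w := fun v w => hF ▸ gauge_add_le hK_conv habs v w
  have hhom : ∀ (t : ℝ) v, 0 ≤ t → F (t • v) = t * F v := fun t v ht =>
    hF ▸ gauge_smul_of_nonneg ht v
  obtain ⟨L, hL⟩ : ∃ L, LipschitzWith L F := hF ▸ hK_conv.lipschitz_gauge hnhds
  obtain ⟨r, hr, hKr⟩ := hK_cpt.isBounded.subset_closedBall_lt 0 0
  have hnorm : ∀ v, ‖v‖ ≤ r * F v := fun v => by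
    have h := le_gauge_of_subset_closedBall (x := v) habs hr.le hKr
    rw [div_le_iff₀ hr, ← hF] at h
    linarith
  have hpos : ∀ v ≠ 0, 0 < F v := fun v hv =>
    pos_of_mul_pos_right ((norm_pos_iff.2 hv).trans_le (hnorm v)) hr.le
  have hFd : ∀ v ≠ 0, DifferentiableAt ℝ F v := fun v hv =>
    (hFsmooth.contDiffAt (isOpen_compl_singleton.mem_nhds hv)).differentiableAt one_ne_zero
  have hball : ∀ v ρ, F v ≤ ρ → ‖v‖ ≤ r * ρ := fun v ρ hv =>
    (hnorm v).trans (mul_le_mul_of_nonneg_left hv hr.le)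
  have hae : ∀ᵐ z ∂μ, F (z - x₀) < R := ae_iff.2 hsupp
  have hae_norm : ∀ᵐ z ∂μ, ‖z‖ ≤ ‖x₀‖ + r * R := by
    filter_upwards [hae] with z hz
    have h1 := hball _ _ hz.le
    have h2 := norm_le_norm_add_norm_sub' z x₀
    linarith
  have hp0 : 0 < p := one_pos.trans hp
  have hGd : Differentiable ℝ fun v => F v ^ p := hL.differentiable_rpow_const h0 hpos hFd hp
  have hEd : Differentiable ℝ E := hE ▸ differentiable_integral_comp_sub hGd
    (hL.rpow_const_lipschitzOnWith h0 hnn hp.le) hae_norm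
  have hint : ∀ y, Integrable (fun z => F (z - y) ^ p) μ := fun y => by
    refine .of_bound (hGd.continuous.comp
      (continuous_id.sub continuous_const)).aestronglyMeasurable ((R + F (x₀ - y)) ^ p) ?_
    filter_upwards [hae] with z hz
    have h1 : F (z - y) ≤ F (z - x₀) + F (x₀ - y) := by simpa using hadd (z - x₀) (x₀ - y)
    have h2 := hnn (z - y)
    rw [Real.norm_of_nonneg (by positivity)]
    exact Real.rpow_le_rpow h2 (by linarith) hp0.le
  have hE0 : E x₀ ≤ R ^ p := by
    have h : ∫ z, F (z - x₀) ^ p ∂μ ≤ ∫ _, R ^ p ∂μ := by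
      refine integral_mono_ae (hint x₀) (integrable_const _) ?_
      filter_upwards [hae] with z hz
      exact Real.rpow_le_rpow (hnn _) hz.le hp0.le
    simpa [hE] using h
  have hsub : ∀ y, E y ≤ E x₀ → F (y - x₀) ≤ C * (1 + C) * R := by
    intro y hy
    suffices h : F (y - x₀) ≤ (1 + C) * R by nlinarith [mul_pos (show 0 < 1 + C by linarith) hR]
    by_contra! hlt
    have hCpos : 0 < C := one_pos.trans_le hC
    set R' := (F (y - x₀) - R) / C with hR'
    have hRR' : R < R' := by rw [hR', lt_div_iff₀ hCpos]; linarith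
    have h : ∫ _, R' ^ p ∂μ ≤ ∫ z, F (z - y) ^ p ∂μ := by
      refine integral_mono_ae (integrable_const _) (hint y) ?_
      filter_upwards [hae] with z hz
      refine Real.rpow_le_rpow (hR.trans hRR').le ?_ hp0.le
      have h1 : F (y - x₀) ≤ F (y - z) + F (z - x₀) := by simpa using hadd (y - z) (z - x₀)
      have h2 := hrev (z - y)
      rw [neg_sub] at h2
      rw [hR', div_le_iff₀ hCpos]
      linarith
    have h' : R' ^ p ≤ E y := by simpa [hE] using h
    linarith [Real.rpow_lt_rpow hR.le hRR' hp0]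
  set S := {y | F (y - x₀) ≤ C * (1 + C) * R} with hS
  have hScpt : IsCompact S := by
    refine Metric.isCompact_of_isClosed_isBounded (isClosed_le
      (hL.continuous.comp (continuous_id.sub continuous_const)) continuous_const) ?_
    refine (Metric.isBounded_closedBall (x := x₀) (r := r * (C * (1 + C) * R))).subset
      fun y hy => ?_
    rw [Metric.mem_closedBall, dist_eq_norm]
    exact hball _ _ hy
  have hx₀S : x₀ ∈ S := by
    have : 0 ≤ C * (1 + C) * R := by positivity
    simpa [hS, h0] using this
  have hFs_le : ∀ w ≠ 0, F w ≤ Fs (ℓ w) := by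
    intro w hw
    have hbdd : BddAbove (ℓ w '' {y | F y ≤ 1}) := by
      refine ⟨‖ℓ w‖ * (r * 1), ?_⟩
      rintro _ ⟨y, hy, rfl⟩
      exact (le_abs_self _).trans (((ℓ w).le_opNorm y).trans
        (mul_le_mul_of_nonneg_left (hball y 1 hy) (norm_nonneg _)))
    have hw' := (hpos w hw).ne'
    rw [hFs]
    refine le_csSup hbdd ⟨(F w)⁻¹ • w, ?_, ?_⟩
    · simp [hhom _ _ (inv_nonneg.2 (hnn w)), hw']
    · rw [map_smul, hℓ w hw, smul_apply,
        fderiv_sq_apply_self_of_homogeneous hhom (hFd w hw)]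
      simp only [smul_eq_mul]
      field_simp
  have hdesc : ∀ k, x k ∈ S →
      F (ℓinv (-(fderiv ℝ E (x k)))) ^ 2 / (2 * C_H) ≤ E (x k) - E (x (k + 1)) := by
    intro k hk
    by_cases hz : fderiv ℝ E (x k) = 0
    · have : ℓinv 0 = 0 := by simpa [hℓ0] using hleft 0
      simp [hz, hstep0 k hz, this, h0]
    set w := ℓinv (-(fderiv ℝ E (x k))) with hw
    have hℓw : ℓ w = -fderiv ℝ E (x k) := hright _
    have hw0 : w ≠ 0 := by
      intro h
      rw [h, hℓ0] at hℓw
      exact hz (neg_eq_zero.1 hℓw.symm)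
    have hFw := hpos w hw0
    have hunit : F ((F w)⁻¹ • w) = 1 := by
      rw [hhom _ _ (inv_nonneg.2 hFw.le), inv_mul_cancel₀ hFw.ne']
    have hslope : fderiv ℝ E (x k) ((F w)⁻¹ • w) = -F w := by
      rw [← neg_neg (fderiv ℝ E (x k)), ← hℓw, neg_apply, map_smul, hℓ w hw0,
        smul_apply, fderiv_sq_apply_self_of_homogeneous hhom (hFd w hw0)]
      simp only [smul_eq_mul]
      field_simp
    have h := hhess (x k) hk _ hunit (F w / C_H) ⟨by positivity, by
      rw [← hℓw]
      gcongr
      exact hFs_le w hw0⟩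
    rw [← hstep k hz, hslope] at h
    have h2 : -F w * (F w / C_H) + C_H / 2 * (F w / C_H) ^ 2 = -(F w ^ 2 / (2 * C_H)) := by
      field_simp
      ring
    linarith
  have hmem : ∀ k, E (x k) ≤ E x₀ := by
    intro k
    induction k with
    | zero => rw [hx0]
    | succ k ih =>
      have h1 := hdesc k (hsub _ ih)
      have h2 : 0 ≤ F (ℓinv (-(fderiv ℝ E (x k)))) ^ 2 / (2 * C_H) := by positivity
      linarith
  have hxS : ∀ k, x k ∈ S := fun k => hsub _ (hmem k)
  obtain ⟨e, heS, hemin⟩ := hScpt.exists_isMinOn ⟨x₀, hx₀S⟩ hEd.continuous.continuousOn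
  have hanti : Antitone fun k => E (x k) := antitone_nat_of_succ_le fun k => by
    have h1 := hdesc k (hxS k)
    have h2 : 0 ≤ F (ℓinv (-(fderiv ℝ E (x k)))) ^ 2 / (2 * C_H) := by positivity
    linarith
  have hElim := tendsto_atTop_ciInf hanti ⟨E e, by rintro _ ⟨k, rfl⟩; exact hemin (hxS k)⟩
  have hgap : Tendsto (fun k => E (x k) - E (x (k + 1))) atTop (𝓝 0) := by
    simpa using hElim.sub (hElim.comp (tendsto_add_atTop_nat 1))
  have hw : Tendsto (fun k => ℓinv (-(fderiv ℝ E (x k)))) atTop (𝓝 0) := by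
    have h1 : Tendsto (fun k => √(2 * C_H * (E (x k) - E (x (k + 1))))) atTop (𝓝 0) := by
      simpa using (hgap.const_mul (2 * C_H)).sqrt
    refine squeeze_zero_norm (a := fun k => r * √(2 * C_H * (E (x k) - E (x (k + 1)))))
      (fun k => hball _ _ (Real.le_sqrt_of_sq_le ?_)) (by simpa using h1.const_mul r)
    have h := hdesc k (hxS k)
    rw [div_le_iff₀ (by positivity)] at h
    linarith
  have hgrad : Tendsto (fun k => fderiv ℝ E (x k)) atTop (𝓝 0) := by
    have h := ((hℓcont.tendsto 0).comp hw).neg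
    simpa [Function.comp_def, hright _, hℓ0] using h
  exact ⟨hxS, e, ⟨heS, fun y hy => hemin hy⟩,
    fun m hm => hEconv.eq_of_isMinOn (fun y hy => hm.2 y hy) hemin hm.1 heS,
    hEconv.tendsto_of_tendsto_fderiv_zero hScpt hEd hxS hgrad heS hemin⟩
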